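/- Assume the Lr (a,τ) interval exchange transformation T is irreducible and satisfies the Keane Condition, and that τ is not split, i.e. τ(j+1) = τ(j)+1 for some j ∈ {1,…,n−1}. Then there exists a pair of distinct points of X which is doubly asymptotic for the shift S; indeed, for x = b^τ_{τ(j)+1−1} = T b_j ∈ D^τ the points 𝓘(x) and 𝓘̃(x) are distinct and doubly asymptotic. -/

import Mathlib

open Set

noncomputable section

/-- `bpt a k = a_1 + ⋯ + a_k` (0-indexed: the sum of the first `k` entries of `a`);
these are the division points `b_k` of the interval exchange. -/
def bpt {n : ℕ} (a : Fin n → ℝ) (k : ℕ) : ℝ :=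
  ∑ j ∈ Finset.univ.filter (fun j : Fin n => (j : ℕ) < k), a j

/-- The left-closed right-open interval `J_i = [b_{i-1}, b_i)` (0-indexed). -/
def Jint {n : ℕ} (a : Fin n → ℝ) (i : Fin n) : Set ℝ :=
  Set.Ico (bpt a (i : ℕ)) (bpt a ((i : ℕ) + 1))

/-- The left-open right-closed interval `J̃_i = (b_{i-1}, b_i]` (0-indexed). -/
def Jtil {n : ℕ} (a : Fin n → ℝ) (i : Fin n) : Set ℝ :=
  Set.Ioc (bpt a (i : ℕ)) (bpt a ((i : ℕ) + 1))

/-- The permuted probability vector `a^τ`, with `a^τ_{τ(i)} = a_i`. -/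
def aperm {n : ℕ} (a : Fin n → ℝ) (τ : Equiv.Perm (Fin n)) : Fin n → ℝ :=
  fun j => a (τ.symm j)

/-- The set `D = {b_1, …, b_{n-1}}` of interior division points. -/
def Dset {n : ℕ} (a : Fin n → ℝ) : Set ℝ :=
  {x | ∃ k : ℕ, 0 < k ∧ k < n ∧ x = bpt a k}

/-- `a` is a positive probability vector. -/
def IsProbVec {n : ℕ} (a : Fin n → ℝ) : Prop :=
  (∀ i, 0 < a i) ∧ ∑ i, a i = 1

/-- `T` is the Lr `(a,τ)` interval exchange transformation: on each
`J_i = [b_{i-1}, b_i)` it is the translation `x ↦ x - b_{i-1} + b^τ_{τ(i)-1}`. -/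
def IsLrIET {n : ℕ} (a : Fin n → ℝ) (τ : Equiv.Perm (Fin n)) (T : ℝ → ℝ) : Prop :=
  ∀ i : Fin n, ∀ x ∈ Jint a i, T x = x - bpt a (i : ℕ) + bpt (aperm a τ) ((τ i : ℕ))

/-- `Tt` is the dual lR `(a,τ)` interval exchange transformation: on each
`J̃_i = (b_{i-1}, b_i]` it is the translation `x ↦ x - b_{i-1} + b^τ_{τ(i)-1}`. -/
def IslRIET {n : ℕ} (a : Fin n → ℝ) (τ : Equiv.Perm (Fin n)) (Tt : ℝ → ℝ) : Prop :=
  ∀ i : Fin n, ∀ x ∈ Jtil a i, Tt x = x - bpt a (i : ℕ) + bpt (aperm a τ) ((τ i : ℕ))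

/-- The Keane Condition: `D ∩ T^k(D) = ∅` for every positive integer `k`. -/
def KeaneCond {n : ℕ} (a : Fin n → ℝ) (T : ℝ → ℝ) : Prop :=
  ∀ k : ℕ, 0 < k → Dset a ∩ (T^[k] '' Dset a) = ∅

/-- `τ` is irreducible: `τ({1,…,j}) ≠ {1,…,j}` for `j = 1, …, n-1` (0-indexed:
no proper initial segment is invariant). -/
def IrreduciblePerm {n : ℕ} (τ : Equiv.Perm (Fin n)) : Prop :=
  ∀ j : ℕ, 0 < j → j < n →
    (fun i => τ i) '' {i : Fin n | (i : ℕ) < j} ≠ {i : Fin n | (i : ℕ) < j}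

/-- `P` is the family of ℤ-iterates of `T` on `[0,1)`: `P 0 = id`,
`P (k+1) = T ∘ P k`, and each `P k` maps `[0,1)` into itself. -/
def IsZIterLr (T : ℝ → ℝ) (P : ℤ → ℝ → ℝ) : Prop :=
  (∀ x ∈ Set.Ico (0 : ℝ) 1, P 0 x = x) ∧
  ∀ k : ℤ, ∀ x ∈ Set.Ico (0 : ℝ) 1, P k x ∈ Set.Ico (0 : ℝ) 1 ∧ P (k + 1) x = T (P k x)

/-- `Pt` is the family of ℤ-iterates of `Tt` on `(0,1]`. -/
def IsZIterlR (Tt : ℝ → ℝ) (Pt : ℤ → ℝ → ℝ) : Prop :=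
  (∀ x ∈ Set.Ioc (0 : ℝ) 1, Pt 0 x = x) ∧
  ∀ k : ℤ, ∀ x ∈ Set.Ioc (0 : ℝ) 1, Pt k x ∈ Set.Ioc (0 : ℝ) 1 ∧ Pt (k + 1) x = Tt (Pt k x)

/-- `I` is the itinerary map of `T` (with ℤ-iterates `P`):
`𝓘(x)_k = i ↔ T^k x ∈ J_i` for `x ∈ [0,1)`. -/
def IsItin {n : ℕ} (a : Fin n → ℝ) (P : ℤ → ℝ → ℝ) (I : ℝ → ℤ → Fin n) : Prop :=
  ∀ x ∈ Set.Ico (0 : ℝ) 1, ∀ k : ℤ, ∀ i : Fin n, (I x k = i ↔ P k x ∈ Jint a i)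

/-- `It` is the itinerary map of `Tt` (with ℤ-iterates `Pt`):
`𝓘̃(x)_k = i ↔ T̃^k x ∈ J̃_i` for `x ∈ (0,1]`. -/
def IsItinDual {n : ℕ} (a : Fin n → ℝ) (Pt : ℤ → ℝ → ℝ) (It : ℝ → ℤ → Fin n) : Prop :=
  ∀ x ∈ Set.Ioc (0 : ℝ) 1, ∀ k : ℤ, ∀ i : Fin n, (It x k = i ↔ Pt k x ∈ Jtil a i)

/-- `D_∞ = {0,1} ∪ ⋃_{k ∈ ℤ} T^k(D)`. -/
def Dinf {n : ℕ} (a : Fin n → ℝ) (P : ℤ → ℝ → ℝ) : Set ℝ :=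
  {0, 1} ∪ ⋃ k : ℤ, P k '' Dset a

/-- The set `R = [0,1] ∖ D_∞` of regular points. -/
def Rset {n : ℕ} (a : Fin n → ℝ) (P : ℤ → ℝ → ℝ) : Set ℝ :=
  Set.Icc 0 1 \ Dinf a P

/-- The shift `S` on `Ω = {1,…,n}^ℤ`: `S(α)_i = α_{i+1}`. -/
def shiftS {n : ℕ} (α : ℤ → Fin n) : ℤ → Fin n := fun i => α (i + 1)

/-- The `k`-th power of the shift: `(S^k α)_i = α_{i+k}`. -/
def shiftZ {n : ℕ} (k : ℤ) (α : ℤ → Fin n) : ℤ → Fin n := fun i => α (i + k)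

/-- `α, β` are positively asymptotic: `α_i = β_i` for all `i ≥ N`, some `N`. -/
def PosAsymp {n : ℕ} (α β : ℤ → Fin n) : Prop :=
  ∃ N : ℕ, ∀ i : ℤ, (N : ℤ) ≤ i → α i = β i

/-- `α, β` are negatively asymptotic: `α_i = β_i` for all `i ≤ -N`, some `N`. -/
def NegAsymp {n : ℕ} (α β : ℤ → Fin n) : Prop :=
  ∃ N : ℕ, ∀ i : ℤ, i ≤ -(N : ℤ) → α i = β i

open Filter Topology

lemma bpt_zero {n : ℕ} (a : Fin n → ℝ) : bpt a 0 = 0 := by simp [bpt]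

lemma bpt_last {n : ℕ} {a : Fin n → ℝ} (ha : IsProbVec a) : bpt a n = 1 := by
  simp [bpt, ha.2]

lemma bpt_succ {n : ℕ} (a : Fin n → ℝ) (i : Fin n) :
    bpt a ((i : ℕ) + 1) = bpt a (i : ℕ) + a i := by
  have h : Finset.univ.filter (fun j : Fin n => (j : ℕ) < (i : ℕ) + 1) =
      insert i (Finset.univ.filter (fun j : Fin n => (j : ℕ) < (i : ℕ))) := by
    ext k
    simp only [Finset.mem_filter, Finset.mem_univ, true_and, Finset.mem_insert, Fin.ext_iff]
    omega
  rw [bpt, h, Finset.sum_insert (by simp), add_comm, bpt]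

lemma bpt_mono {n : ℕ} {a : Fin n → ℝ} (ha : IsProbVec a) : Monotone (bpt a) := by
  intro k l hkl
  refine Finset.sum_le_sum_of_subset_of_nonneg ?_ fun i _ _ => (ha.1 i).le
  intro i hi
  simp only [Finset.mem_filter, Finset.mem_univ, true_and] at hi ⊢
  omega

lemma bpt_lt {n : ℕ} {a : Fin n → ℝ} (ha : IsProbVec a) {k l : ℕ} (hkl : k < l) (hl : l ≤ n) :
    bpt a k < bpt a l := by
  have h1 := bpt_succ a ⟨k, by omega⟩
  have h2 := ha.1 ⟨k, by omega⟩
  have h3 := bpt_mono ha (Nat.succ_le_of_lt hkl)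
  simp only [Nat.succ_eq_add_one] at h1 h3
  linarith

lemma IsProbVec.aperm {n : ℕ} {a : Fin n → ℝ} (ha : IsProbVec a) (τ : Equiv.Perm (Fin n)) :
    IsProbVec (aperm a τ) :=
  ⟨fun _ => ha.1 _, (Equiv.sum_comp τ.symm a).trans ha.2⟩

lemma bpt_aperm_succ {n : ℕ} (a : Fin n → ℝ) (τ : Equiv.Perm (Fin n)) (i : Fin n) :
    bpt (aperm a τ) ((τ i : ℕ) + 1) = bpt (aperm a τ) (τ i : ℕ) + a i := by
  rw [bpt_succ]; simp [aperm]

lemma Jint_subset {n : ℕ} {a : Fin n → ℝ} (ha : IsProbVec a) (i : Fin n) :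
    Jint a i ⊆ Ico 0 1 := by
  rintro x ⟨h1, h2⟩
  have h3 := bpt_mono ha (Nat.zero_le i)
  have h4 := bpt_mono ha i.2
  rw [bpt_zero] at h3
  rw [Nat.succ_eq_add_one, bpt_last ha] at h4
  exact ⟨by linarith, by linarith⟩

lemma Jint_unique {n : ℕ} {a : Fin n → ℝ} (ha : IsProbVec a) {i k : Fin n} {x : ℝ}
    (hi : x ∈ Jint a i) (hk : x ∈ Jint a k) : i = k := by
  by_contra hne
  rcases lt_or_gt_of_ne hne with h | h
  · exact absurd (bpt_mono ha (Nat.succ_le_of_lt h)) (by have := hi.2; have := hk.1; simp; linarith)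
  · exact absurd (bpt_mono ha (Nat.succ_le_of_lt h)) (by have := hk.2; have := hi.1; simp; linarith)

lemma Jtil_unique {n : ℕ} {a : Fin n → ℝ} (ha : IsProbVec a) {i k : Fin n} {x : ℝ}
    (hi : x ∈ Jtil a i) (hk : x ∈ Jtil a k) : i = k := by
  by_contra hne
  rcases lt_or_gt_of_ne hne with h | h
  · exact absurd (bpt_mono ha (Nat.succ_le_of_lt h)) (by have := hi.2; have := hk.1; simp; linarith)
  · exact absurd (bpt_mono ha (Nat.succ_le_of_lt h)) (by have := hk.2; have := hi.1; simp; linarith)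

lemma IsLrIET.mapsTo {n : ℕ} {a : Fin n → ℝ} {τ : Equiv.Perm (Fin n)} {T : ℝ → ℝ}
    (hT : IsLrIET a τ T) {i : Fin n} {x : ℝ} (hx : x ∈ Jint a i) :
    T x ∈ Jint (aperm a τ) (τ i) := by
  have h1 := bpt_aperm_succ a τ i
  have h2 := bpt_succ a i
  rw [hT i x hx]
  exact ⟨by linarith [hx.1], by linarith [hx.2]⟩

lemma IslRIET.mapsTo {n : ℕ} {a : Fin n → ℝ} {τ : Equiv.Perm (Fin n)} {T : ℝ → ℝ}
    (hT : IslRIET a τ T) {i : Fin n} {x : ℝ} (hx : x ∈ Jtil a i) :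
    T x ∈ Jtil (aperm a τ) (τ i) := by
  have h1 := bpt_aperm_succ a τ i
  have h2 := bpt_succ a i
  rw [hT i x hx]
  exact ⟨by linarith [hx.1], by linarith [hx.2]⟩

lemma IsLrIET.inj {n : ℕ} {a : Fin n → ℝ} (ha : IsProbVec a) {τ : Equiv.Perm (Fin n)}
    {T : ℝ → ℝ} (hT : IsLrIET a τ T) {i k : Fin n} {x y : ℝ} (hx : x ∈ Jint a i)
    (hy : y ∈ Jint a k) (h : T x = T y) : x = y := by
  have hik : i = k := τ.injective (Jint_unique (ha.aperm τ) (hT.mapsTo hx) (h ▸ hT.mapsTo hy))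
  subst hik
  have h1 := hT i x hx
  have h2 := hT i y hy
  linarith

lemma IslRIET.inj {n : ℕ} {a : Fin n → ℝ} (ha : IsProbVec a) {τ : Equiv.Perm (Fin n)}
    {T : ℝ → ℝ} (hT : IslRIET a τ T) {i k : Fin n} {x y : ℝ} (hx : x ∈ Jtil a i)
    (hy : y ∈ Jtil a k) (h : T x = T y) : x = y := by
  have hik : i = k := τ.injective (Jtil_unique (ha.aperm τ) (hT.mapsTo hx) (h ▸ hT.mapsTo hy))
  subst hik
  have h1 := hT i x hx
  have h2 := hT i y hy
  linarith

/-- Off the division points the half-open intervals of the two conventions agree. -/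
lemma mem_Jtil_of_mem_Jint {n : ℕ} {a : Fin n → ℝ} {i : Fin n} {x : ℝ}
    (hx : x ∈ Jint a i) (h0 : x ≠ 0) (hD : x ∉ Dset a) : x ∈ Jtil a i := by
  refine ⟨lt_of_le_of_ne hx.1 fun h => ?_, hx.2.le⟩
  rcases Nat.eq_zero_or_pos (i : ℕ) with hi | hi
  · rw [hi, bpt_zero] at h
    exact h0 h.symm
  · exact hD ⟨i, hi, i.2, h.symm⟩

lemma IsZIterLr.iterate {T : ℝ → ℝ} {P : ℤ → ℝ → ℝ} (hP : IsZIterLr T P) {x : ℝ}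
    (hx : x ∈ Ico (0 : ℝ) 1) (k : ℤ) (m : ℕ) : T^[m] (P k x) = P (k + m) x := by
  induction m with
  | zero => simp
  | succ m ih =>
    rw [Function.iterate_succ_apply', ih, ← (hP.2 _ x hx).2]
    push_cast
    ring_nf

/-- If `T` translates `z k + h` to `z (k + 1) + h` for `h` eventually along `F`, for each `k`,
then the orbit of `z 0 + h` is the translated sequence `z k + h`, eventually for each `k`. -/
lemma eventually_iter_eq {T : ℝ → ℝ} {P : ℤ → ℝ → ℝ} (hP : IsZIterLr T P)
    (hinj : InjOn T (Ico 0 1)) {F : Filter ℝ} {z : ℤ → ℝ}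
    (hmem : ∀ k, ∀ᶠ h in F, z k + h ∈ Ico (0 : ℝ) 1)
    (hstep : ∀ k, ∀ᶠ h in F, T (z k + h) = z (k + 1) + h) (k : ℤ) :
    ∀ᶠ h in F, P k (z 0 + h) = z k + h := by
  induction k using Int.induction_on with
  | zero => filter_upwards [hmem 0] with h h0 using hP.1 _ h0
  | succ k ih =>
    filter_upwards [hmem 0, hstep k, ih] with h h0 hs hk
    rw [(hP.2 _ _ h0).2, hk, hs]
  | pred k ih =>
    filter_upwards [hmem 0, hmem (-k - 1), hstep (-k - 1), ih] with h h0 hm hs hk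
    refine hinj (hP.2 _ _ h0).1 hm ?_
    rw [← (hP.2 _ _ h0).2, hs, sub_add_cancel, hk]

lemma countable_Dinf {n : ℕ} (a : Fin n → ℝ) (P : ℤ → ℝ → ℝ) : (Dinf a P).Countable := by
  have hD : (Dset a).Countable :=
    (countable_range (bpt a)).mono (by rintro x ⟨k, -, -, rfl⟩; exact ⟨k, rfl⟩)
  exact ((countable_singleton 1).insert 0).union (countable_iUnion fun k => hD.image _)

lemma mem_closure_itin {n : ℕ} {a : Fin n → ℝ} (ha : IsProbVec a) {T : ℝ → ℝ}
    {P : ℤ → ℝ → ℝ} (hP : IsZIterLr T P) (hinj : InjOn T (Ico 0 1)) {I : ℝ → ℤ → Fin n}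
    (hI : IsItin a P I) {F : Filter ℝ} (hF : ∀ s ∈ F, ¬ s.Countable) {z : ℤ → ℝ}
    {α : ℤ → Fin n} (hmem : ∀ k, ∀ᶠ h in F, z k + h ∈ Jint a (α k))
    (hstep : ∀ k, ∀ᶠ h in F, T (z k + h) = z (k + 1) + h) :
    α ∈ closure (I '' Rset a P) := by
  have hmem' : ∀ k, ∀ᶠ h in F, z k + h ∈ Ico (0 : ℝ) 1 := fun k =>
    (hmem k).mono fun h hh => Jint_subset ha _ hh
  refine mem_closure_of_frequently_of_tendsto (b := F) (f := fun h => I (z 0 + h)) ?_ ?_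
  · intro hc
    refine hF _ (hc.and (hmem' 0)) ?_
    refine ((countable_Dinf a P).preimage (add_right_injective (z 0))).mono ?_
    rintro h ⟨h1, h2⟩
    by_contra h3
    exact h1 ⟨_, ⟨⟨h2.1, h2.2.le⟩, h3⟩, rfl⟩
  · rw [tendsto_pi_nhds]
    intro k
    refine tendsto_nhds_of_eventually_eq ?_
    filter_upwards [hmem k, hmem' 0, eventually_iter_eq hP hinj hmem' hstep k] with h h1 h2 h3
    rw [hI _ h2, h3]
    exact h1

lemma not_countable_of_mem_nhdsGT {s : Set ℝ} (hs : s ∈ 𝓝[>] (0 : ℝ)) : ¬ s.Countable := by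
  obtain ⟨u, hu, hsub⟩ := mem_nhdsGT_iff_exists_Ioo_subset.1 hs
  intro h
  have := (Cardinal.le_aleph0_iff_set_countable.2 (h.mono hsub))
  rw [Cardinal.mk_Ioo_real hu] at this
  exact absurd this (not_le.2 Cardinal.aleph0_lt_continuum)

lemma not_countable_of_mem_nhdsLT {s : Set ℝ} (hs : s ∈ 𝓝[<] (0 : ℝ)) : ¬ s.Countable := by
  obtain ⟨u, hu, hsub⟩ := mem_nhdsLT_iff_exists_Ioo_subset.1 hs
  intro h
  have := (Cardinal.le_aleph0_iff_set_countable.2 (h.mono hsub))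
  rw [Cardinal.mk_Ioo_real hu] at this
  exact absurd this (not_le.2 Cardinal.aleph0_lt_continuum)

lemma eventually_add_mem_Jint_right {n : ℕ} {a : Fin n → ℝ} {i : Fin n} {z : ℝ}
    (hz : z ∈ Jint a i) : ∀ᶠ h in 𝓝[>] (0 : ℝ), z + h ∈ Jint a i := by
  filter_upwards [Ioo_mem_nhdsGT (sub_pos.2 hz.2)] with h hh
  exact ⟨by linarith [hz.1, hh.1], by linarith [hh.2]⟩

lemma eventually_add_mem_Jint_left {n : ℕ} {a : Fin n → ℝ} {i : Fin n} {z : ℝ}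
    (hz : z ∈ Jtil a i) : ∀ᶠ h in 𝓝[<] (0 : ℝ), z + h ∈ Jint a i := by
  filter_upwards [Ioo_mem_nhdsLT (sub_neg.2 hz.1)] with h hh
  exact ⟨by linarith [hh.1], by linarith [hz.2, hh.2]⟩

/-- Under irreducibility, `0` is the image of an interior division point. -/
lemma IrreduciblePerm.exists_map_eq_zero {n : ℕ} (hn : 2 ≤ n) {a : Fin n → ℝ}
    (ha : IsProbVec a) {τ : Equiv.Perm (Fin n)} (hirr : IrreduciblePerm τ) {T : ℝ → ℝ}
    (hT : IsLrIET a τ T) :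
    ∃ d ∈ Dset a, ∃ i, d ∈ Jint a i ∧ T d = 0 := by
  let o : Fin n := ⟨0, by omega⟩
  have hi : 0 < (τ.symm o : ℕ) := by
    rw [Nat.pos_iff_ne_zero]
    intro h
    have h1 : τ o = o := by
      rw [← Equiv.eq_symm_apply]
      exact (Fin.ext h).symm
    refine hirr 1 one_pos (by omega) ?_
    have hs : {i : Fin n | (i : ℕ) < 1} = {o} := by
      ext k
      simp [o, Fin.ext_iff]
    rw [hs, image_singleton, h1]
  have hd : bpt a (τ.symm o) ∈ Jint a (τ.symm o) :=
    ⟨le_rfl, bpt_lt ha (Nat.lt_succ_self _) (τ.symm o).2⟩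
  refine ⟨_, ⟨_, hi, (τ.symm o).2, rfl⟩, _, hd, ?_⟩
  rw [hT _ _ hd]
  simp [o, bpt_zero]

/-- Theorem 4.5 (iv), converse part: if `T` is irreducible, satisfies
the Keane Condition and `τ` is not split, i.e. `τ(j+1) = τ(j) + 1` for some
`j ∈ {1,…,n-1}`, then for `x = b^τ_{τ(j+1)-1} = T b_j ∈ D^τ` the points `𝓘(x)` and
`𝓘̃(x)` are distinct points of `X` which are doubly asymptotic for the shift. -/
theorem stmt19 {n : ℕ} (hn : 2 ≤ n) (a : Fin n → ℝ) (ha : IsProbVec a)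
    (τ : Equiv.Perm (Fin n)) (T Tt : ℝ → ℝ)
    (hT : IsLrIET a τ T) (hTt : IslRIET a τ Tt)
    (P Pt : ℤ → ℝ → ℝ) (hP : IsZIterLr T P) (hPt : IsZIterlR Tt Pt)
    (I It : ℝ → ℤ → Fin n) (hI : IsItin a P I) (hIt : IsItinDual a Pt It)
    (hirr : IrreduciblePerm τ) (hKeane : KeaneCond a T)
    (j j' : Fin n) (hj' : (j' : ℕ) = (j : ℕ) + 1)
    (hnotsplit : (τ j' : ℕ) = (τ j : ℕ) + 1) :
    T (bpt a ((j : ℕ) + 1)) = bpt (aperm a τ) ((τ j : ℕ) + 1) ∧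
    bpt (aperm a τ) ((τ j : ℕ) + 1) ∈ Dset (aperm a τ) ∧
    I (bpt (aperm a τ) ((τ j : ℕ) + 1)) ∈ closure (I '' Rset a P) ∧
    It (bpt (aperm a τ) ((τ j : ℕ) + 1)) ∈ closure (I '' Rset a P) ∧
    I (bpt (aperm a τ) ((τ j : ℕ) + 1)) ≠ It (bpt (aperm a τ) ((τ j : ℕ) + 1)) ∧
    PosAsymp (I (bpt (aperm a τ) ((τ j : ℕ) + 1)))
      (It (bpt (aperm a τ) ((τ j : ℕ) + 1))) ∧
    NegAsymp (I (bpt (aperm a τ) ((τ j : ℕ) + 1)))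
      (It (bpt (aperm a τ) ((τ j : ℕ) + 1))) := by
  have hinj : InjOn T (Ico 0 1) := by
    intro x hx y hy h
    have h1 := (hI x hx 0 _).1 rfl
    have h2 := (hI y hy 0 _).1 rfl
    rw [hP.1 _ hx] at h1
    rw [hP.1 _ hy] at h2
    exact hT.inj ha h1 h2 h
  have hinjt : InjOn Tt (Ioc 0 1) := by
    intro x hx y hy h
    have h1 := (hIt x hx 0 _).1 rfl
    have h2 := (hIt y hy 0 _).1 rfl
    rw [hPt.1 _ hx] at h1
    rw [hPt.1 _ hy] at h2
    exact hTt.inj ha h1 h2 h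
  set c := bpt a ((j : ℕ) + 1) with hc
  set x := bpt (aperm a τ) ((τ j : ℕ) + 1) with hx
  have hcJ : c ∈ Jint a j' := by
    rw [hc, ← hj']
    exact ⟨le_rfl, bpt_lt ha (Nat.lt_succ_self _) j'.2⟩
  have hcJt : c ∈ Jtil a j := ⟨bpt_lt ha (Nat.lt_succ_self _) j.2, le_rfl⟩
  have hcD : c ∈ Dset a := ⟨j + 1, by omega, by omega, rfl⟩
  have hTc : T c = x := by
    rw [hT _ _ hcJ, hnotsplit, hj', ← hc, ← hx]
    ring
  have hTtc : Tt c = x := by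
    rw [hTt _ _ hcJt, hx, bpt_aperm_succ, hc, bpt_succ]
    ring
  have hxD : x ∈ Dset (aperm a τ) := ⟨_, by omega, by omega, rfl⟩
  have hx0 : 0 < x := by
    rw [← bpt_zero (aperm a τ)]
    exact bpt_lt (ha.aperm τ) (by omega) (by omega)
  have hx1 : x < 1 := by
    rw [← bpt_last (ha.aperm τ)]
    exact bpt_lt (ha.aperm τ) (by omega) (by omega)
  have hxI : x ∈ Ico (0 : ℝ) 1 := ⟨hx0.le, hx1⟩
  have hxIt : x ∈ Ioc (0 : ℝ) 1 := ⟨hx0, hx1.le⟩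
  have hPJ : ∀ k, P k x ∈ Jint a (I x k) := fun k => (hI x hxI k _).1 rfl
  have hPtJ : ∀ k, Pt k x ∈ Jtil a (It x k) := fun k => (hIt x hxIt k _).1 rfl
  have hKeane' : ∀ d ∈ Dset a, ∀ k : ℕ, 0 < k → T^[k] d ∉ Dset a := fun d hd k hk h =>
    (hKeane k hk).le ⟨h, d, hd, rfl⟩
  have hPc : P (-1) x = c := by
    refine hinj (hP.2 _ _ hxI).1 (Jint_subset ha _ hcJ) ?_
    rw [← (hP.2 _ _ hxI).2, hTc]
    exact hP.1 _ hxI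
  have hPtc : Pt (-1) x = c := by
    refine hinjt (hPt.2 _ _ hxIt).1 ?_ ?_
    · have h1 := Jint_subset ha _ hcJ
      refine ⟨lt_of_le_of_lt ?_ hcJt.1, h1.2.le⟩
      rw [← bpt_zero a]
      exact bpt_mono ha (Nat.zero_le _)
    rw [← (hPt.2 _ _ hxIt).2, hTtc]
    exact hPt.1 _ hxIt
  obtain ⟨d, hdD, i₀, hdJ, hd0⟩ := hirr.exists_map_eq_zero hn ha hT
  have hgood : ∀ k : ℤ, k ≠ -1 → P k x ∉ Dset a := by
    intro k hk h
    rcases lt_or_gt_of_ne hk with hk | hk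
    · obtain ⟨m, hm⟩ := Int.eq_ofNat_of_zero_le (show 0 ≤ -1 - k by omega)
      refine hKeane' _ h m (by omega) ?_
      rw [hP.iterate hxI, ← hm, add_sub_cancel, hPc]
      exact hcD
    · obtain ⟨m, hm⟩ := Int.eq_ofNat_of_zero_le (show 0 ≤ k + 1 by omega)
      refine hKeane' c hcD m (by omega) ?_
      rw [← hPc, hP.iterate hxI, ← hm, neg_add_cancel_comm_assoc]
      exact h
  have hgood0 : ∀ k : ℤ, k ≠ -1 → P k x ≠ 0 := by
    intro k hk h
    have hprev : P (k - 1) x = d := by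
      refine hinj (hP.2 _ _ hxI).1 (Jint_subset ha _ hdJ) ?_
      rw [← (hP.2 _ _ hxI).2, hd0, sub_add_cancel, h]
    by_cases hk0 : k = 0
    · rw [hk0, hP.1 _ hxI] at h
      exact hx0.ne' h
    · refine hgood (k - 1) (by omega) ?_
      rw [hprev]
      exact hdD
  have hmemt : ∀ k : ℤ, k ≠ -1 → P k x ∈ Jtil a (I x k) := fun k hk =>
    mem_Jtil_of_mem_Jint (hPJ k) (hgood0 k hk) (hgood k hk)
  have hTTt : ∀ k : ℤ, Tt (P k x) = T (P k x) := by
    intro k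
    by_cases hk : k = -1
    · rw [hk, hPc, hTc, hTtc]
    · rw [hT _ _ (hPJ k), hTt _ _ (hmemt k hk)]
  have hpos : ∀ k : ℤ, P k x ∈ Ioc (0 : ℝ) 1 := by
    intro k
    have h1 := (hP.2 k _ hxI).1
    refine ⟨lt_of_le_of_ne h1.1 fun h => ?_, h1.2.le⟩
    by_cases hk : k = -1
    · have h2 := (hPt.2 (-1) _ hxIt).1.1
      rw [hPtc, ← hPc, ← hk, ← h] at h2
      exact h2.false
    · exact hgood0 k hk h.symm
  have heq : ∀ k : ℤ, Pt k x = P k x := by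
    intro k
    induction k using Int.induction_on with
    | zero => rw [hPt.1 _ hxIt, hP.1 _ hxI]
    | succ k ih => rw [(hPt.2 _ _ hxIt).2, (hP.2 _ _ hxI).2, ih, hTTt]
    | pred k ih =>
      refine hinjt (hPt.2 _ _ hxIt).1 (hpos _) ?_
      rw [← (hPt.2 _ _ hxIt).2, hTTt, ← (hP.2 _ _ hxI).2, sub_add_cancel, ih]
  have hII : ∀ k : ℤ, k ≠ -1 → I x k = It x k := fun k hk =>
    Jtil_unique ha (hmemt k hk) (heq k ▸ hPtJ k)
  refine ⟨hTc, hxD, ?_, ?_, ?_, ⟨0, fun k hk => hII k (by simp at hk; omega)⟩,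
    ⟨2, fun k hk => hII k (by simp at hk; omega)⟩⟩
  · refine mem_closure_itin ha hP hinj hI (F := 𝓝[>] 0)
      (fun s hs => not_countable_of_mem_nhdsGT hs) (z := fun k => P k x)
      (fun k => eventually_add_mem_Jint_right (hPJ k)) fun k => ?_
    filter_upwards [eventually_add_mem_Jint_right (hPJ k)] with h hh
    rw [hT _ _ hh, (hP.2 _ _ hxI).2, hT _ _ (hPJ k)]
    ring
  · refine mem_closure_itin ha hP hinj hI (F := 𝓝[<] 0)
      (fun s hs => not_countable_of_mem_nhdsLT hs) (z := fun k => Pt k x)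
      (fun k => eventually_add_mem_Jint_left (hPtJ k)) fun k => ?_
    filter_upwards [eventually_add_mem_Jint_left (hPtJ k)] with h hh
    rw [hT _ _ hh, (hPt.2 _ _ hxIt).2, hTt _ _ (hPtJ k)]
    ring
  · intro h
    have h1 : I x (-1) = j' := (hI x hxI _ _).2 (hPc ▸ hcJ)
    have h2 : It x (-1) = j := (hIt x hxIt _ _).2 (hPtc ▸ hcJt)
    have h3 : j' = j := by rw [← h1, h, h2]
    rw [h3] at hj'
    omega
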